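/- arXiv:2507.07510 — 2 statements merged into one kernel-verified Lean document; each statement's English description precedes it below -/
import Mathlib

section
/- At the unique critical point u₁ of g (i.e., the unique real with g'(u₁) = 0), g attains its global maximum over ℝ, and g(u₁) > g(L − 1) = 2·exp(L − 1) > 0. -/
/-- The logistic sigmoid σ(u) = 1/(1+exp(−u)). -/
noncomputable def sigmoid (u : ℝ) : ℝ := 1 / (1 + Real.exp (-u))

/-- L := log((1−α)/α). -/
noncomputable def L (α : ℝ) : ℝ := Real.log ((1 - α) / α)

/-- f(u) := σ(u)·log(σ(u)/(1−α)) + σ(−u)·log(σ(−u)/α). -/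
noncomputable def f (α : ℝ) (u : ℝ) : ℝ :=
  sigmoid u * Real.log (sigmoid u / (1 - α)) + sigmoid (-u) * Real.log (sigmoid (-u) / α)

/-- g(u) := −u·exp(u) + (L+1)·exp(u) + u + 1 − L. -/
noncomputable def g (α : ℝ) (u : ℝ) : ℝ :=
  -u * Real.exp u + (L α + 1) * Real.exp u + u + 1 - L α

theorem hasDerivAt_g (α u : ℝ) : HasDerivAt (g α) ((L α - u) * Real.exp u + 1) u := by
  have h := (((((hasDerivAt_id u).neg.mul (Real.hasDerivAt_exp u)).add
    ((Real.hasDerivAt_exp u).const_mul (L α + 1))).add (hasDerivAt_id u)).add_const 1).sub_const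
      (L α)
  refine h.congr_deriv ?_
  simp only [Pi.neg_apply, id_eq]
  ring

theorem deriv_g_eq_zero_iff (α u : ℝ) : deriv (g α) u = 0 ↔ (u - L α) * Real.exp u = 1 := by
  rw [(hasDerivAt_g α u).deriv]
  constructor <;> intro h <;> linarith

/-- A critical point of `g` is a strict global maximum. -/
theorem g_lt_g_of_critical {α v u : ℝ} (hv : (v - L α) * Real.exp v = 1) (hne : u ≠ v) :
    g α u < g α v := by
  have hd : u - v ≠ 0 := sub_ne_zero.mpr hne
  have h₁ := Real.add_one_lt_exp hd
  have h₂ : Real.exp (u - v) * (1 - (u - v)) < 1 := by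
    have h := mul_lt_mul_of_pos_left (Real.add_one_lt_exp (neg_ne_zero.mpr hd))
      (Real.exp_pos (u - v))
    rw [← Real.exp_add, add_neg_cancel, Real.exp_zero] at h
    linarith
  have h₃ := mul_lt_mul_of_pos_left h₂ (Real.exp_pos v)
  have hu : Real.exp u = Real.exp v * Real.exp (u - v) := by
    rw [← Real.exp_add, add_sub_cancel]
  have key : g α v - g α u =
      (Real.exp v * 1 - Real.exp v * (Real.exp (u - v) * (1 - (u - v))))
        + (Real.exp (u - v) - (u - v + 1)) := by
    unfold g
    rw [hu]
    linear_combination (Real.exp (u - v) - 1) * hv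
  linarith

theorem exists_sub_mul_exp_eq_one (l : ℝ) : ∃ u : ℝ, (u - l) * Real.exp u = 1 := by
  have hpos := Real.exp_pos (-l)
  have hcont : ContinuousOn (fun u : ℝ => (u - l) * Real.exp u)
      (Set.Icc l (l + Real.exp (-l))) := by fun_prop
  have hmem : (1 : ℝ) ∈ Set.Icc ((l - l) * Real.exp l)
      ((l + Real.exp (-l) - l) * Real.exp (l + Real.exp (-l))) := by
    constructor
    · simp
    · rw [add_sub_cancel_left, ← Real.exp_add, Real.one_le_exp_iff]
      linarith
  obtain ⟨u, -, hu⟩ := intermediate_value_Icc (by linarith) hcont hmem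
  exact ⟨u, hu⟩

theorem stmt_10 (α : ℝ) (hα : α ∈ Set.Ioo (0 : ℝ) 1) :
    ∃ u₁ : ℝ, deriv (g α) u₁ = 0 ∧ (∀ u : ℝ, deriv (g α) u = 0 → u = u₁) ∧
      (∀ u : ℝ, g α u ≤ g α u₁) ∧
      g α (L α - 1) < g α u₁ ∧
      g α (L α - 1) = 2 * Real.exp (L α - 1) ∧
      0 < 2 * Real.exp (L α - 1) := by
  obtain ⟨v, hv⟩ := exists_sub_mul_exp_eq_one (L α)
  refine ⟨v, (deriv_g_eq_zero_iff α v).mpr hv, fun u hu => ?_, fun u => ?_,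
    g_lt_g_of_critical hv ?_, ?_, by positivity⟩
  · by_contra hne
    exact lt_asymm (g_lt_g_of_critical hv hne)
      (g_lt_g_of_critical ((deriv_g_eq_zero_iff α u).mp hu) (Ne.symm hne))
  · rcases eq_or_ne u v with rfl | hne
    · exact le_rfl
    · exact (g_lt_g_of_critical hv hne).le
  · rintro rfl
    linarith [Real.exp_pos (L α - 1)]
  · unfold g
    ring
end

section
/- For every α ∈ (0,1), if h₁ < 0 < h₂ are real numbers such that g(u) > 0 for every u in the open interval (h₁, h₂), then f''(u) > 0 on (h₁, h₂) and f is strictly convex on the interval (h₁, h₂). -/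
theorem f_eq {α : ℝ} (hα : α ∈ Set.Ioo (0 : ℝ) 1) (u : ℝ) :
    f α u = (Real.exp u * (u - Real.log (1 - α)) - Real.log α) / (1 + Real.exp u)
      - Real.log (1 + Real.exp u) := by
  have hE := Real.exp_pos u
  have hE' : 1 + Real.exp u ≠ 0 := by positivity
  have hα₀ : α ≠ 0 := hα.1.ne'
  have hα₁ : 1 - α ≠ 0 := (sub_pos.2 hα.2).ne'
  have hs : sigmoid u = Real.exp u / (1 + Real.exp u) := by
    rw [sigmoid, Real.exp_neg]
    field_simp
    ring
  have hs' : sigmoid (-u) = 1 / (1 + Real.exp u) := by rw [sigmoid, neg_neg]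
  rw [f, hs, hs', Real.log_div (by positivity) hα₁, Real.log_div hE.ne' hE',
    Real.log_div (by positivity) hα₀, Real.log_div one_ne_zero hE', Real.log_exp, Real.log_one]
  field_simp
  ring

theorem hasDerivAt_f {α : ℝ} (hα : α ∈ Set.Ioo (0 : ℝ) 1) (u : ℝ) :
    HasDerivAt (f α) (Real.exp u * (u - L α) / (1 + Real.exp u) ^ 2) u := by
  have hE' : 1 + Real.exp u ≠ 0 := by positivity
  have hL : L α = Real.log (1 - α) - Real.log α :=
    Real.log_div (sub_pos.2 hα.2).ne' hα.1.ne'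
  have hd : HasDerivAt (fun x => 1 + Real.exp x) (Real.exp u) u :=
    (Real.hasDerivAt_exp u).const_add 1
  have hn := ((Real.hasDerivAt_exp u).mul
    ((hasDerivAt_id' u).sub_const (Real.log (1 - α)))).sub_const (Real.log α)
  rw [funext (f_eq hα)]
  refine ((hn.div hd hE').sub (hd.log hE')).congr_deriv ?_
  simp only [Pi.mul_apply]
  rw [hL]
  field_simp
  ring

theorem hasDerivAt_deriv_f {α : ℝ} (hα : α ∈ Set.Ioo (0 : ℝ) 1) (u : ℝ) :
    HasDerivAt (deriv (f α)) (Real.exp u * g α u / (1 + Real.exp u) ^ 3) u := by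
  have hE' : 1 + Real.exp u ≠ 0 := by positivity
  have hd : HasDerivAt (fun x => 1 + Real.exp x) (Real.exp u) u :=
    (Real.hasDerivAt_exp u).const_add 1
  have hn := (Real.hasDerivAt_exp u).mul ((hasDerivAt_id' u).sub_const (L α))
  rw [funext fun x => (hasDerivAt_f hα x).deriv]
  refine (hn.div (hd.pow 2) (pow_ne_zero 2 hE')).congr_deriv ?_
  simp only [Pi.mul_apply, Pi.pow_apply, g]
  field_simp
  push_cast
  ring

theorem stmt_12 (α : ℝ) (hα : α ∈ Set.Ioo (0 : ℝ) 1) (h₁ h₂ : ℝ)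
    (hh₁ : h₁ < 0) (hh₂ : 0 < h₂) (hg : ∀ u ∈ Set.Ioo h₁ h₂, 0 < g α u) :
    (∀ u ∈ Set.Ioo h₁ h₂, 0 < deriv (deriv (f α)) u) ∧
    StrictConvexOn ℝ (Set.Ioo h₁ h₂) (f α) := by
  have hpos : ∀ u ∈ Set.Ioo h₁ h₂, 0 < deriv (deriv (f α)) u := fun u hu => by
    rw [(hasDerivAt_deriv_f hα u).deriv]
    have := hg u hu
    positivity
  refine ⟨hpos, strictConvexOn_of_deriv2_pos' (convex_Ioo h₁ h₂) ?_ hpos⟩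
  exact fun u _ => (hasDerivAt_f hα u).continuousAt.continuousWithinAt
end
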